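/- arXiv:2201.00275 — 3 statements merged into one kernel-verified Lean document; each statement's English description precedes it below -/
import Mathlib

section
/- Let A ⊆ ℝ^n be an irreducible algebraic set, and suppose A ⊆ ⋃_{i∈ℕ} B_i where each B_i is an algebraic subset of ℝ^n. Then there exists i with A ⊆ B_i. -/
open scoped nonZeroDivisors in
/-- A finite extension of domains in characteristic zero with integrally closed base is generated by
one element, up to multiplication by a nonzero element of the base. -/
theorem exists_almost_primitive_element (A R : Type*) [CommRing A] [IsDomain A]
    [IsIntegrallyClosed A] [CharZero A] [CommRing R] [IsDomain R] [Algebra A R] [FaithfulSMul A R]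
    [Module.Finite A R] :
    ∃ (θ : R) (c : A), c ≠ 0 ∧ (∀ r : R, ∃ p : Polynomial A, Polynomial.aeval θ p = c • r) ∧
      Polynomial.aeval θ (Polynomial.derivative (minpoly A θ)) ≠ 0 := by
  let K := FractionRing A
  let L := FractionRing R
  let : Algebra K L := FractionRing.liftAlgebra A L
  have : Module.Finite K L := Module.Finite.of_isLocalization A R A⁰
  have hinj : Function.Injective (algebraMap R L) := IsFractionRing.injective R L
  obtain ⟨α, hα⟩ := Field.exists_primitive_element K L
  obtain ⟨⟨θ, s, hs⟩, hθ⟩ := IsLocalization.surj (Algebra.algebraMapSubmonoid R A⁰) α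
  obtain ⟨s, hs, rfl⟩ := hs
  have hs0 : algebraMap A K s ≠ 0 := by simpa using nonZeroDivisors.ne_zero hs
  have hθ' : algebraMap R L θ = algebraMap A K s • α := by
    rw [← hθ, Algebra.smul_def, ← IsScalarTower.algebraMap_apply A K L,
      IsScalarTower.algebraMap_apply A R L, mul_comm]
  have hint : IsIntegral A θ := Algebra.IsIntegral.isIntegral θ
  have hadj : Algebra.adjoin K {algebraMap R L θ} = ⊤ := by
    rw [eq_top_iff, ← IntermediateField.top_toSubalgebra, ← hα,
      IntermediateField.adjoin_simple_toSubalgebra_of_isAlgebraic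
        (Algebra.IsAlgebraic.isAlgebraic α)]
    refine Algebra.adjoin_le (Set.singleton_subset_iff.2 ?_)
    have : α = (algebraMap A K s)⁻¹ • algebraMap R L θ := by
      rw [hθ', smul_smul, inv_mul_cancel₀ hs0, one_smul]
    rw [this]
    exact Subalgebra.smul_mem _ (Algebra.self_mem_adjoin_singleton _ _) _
  have hone : ∀ r : R, ∃ c : A, c ≠ 0 ∧ ∃ p : Polynomial A, Polynomial.aeval θ p = c • r := by
    intro r
    have hr : algebraMap R L r ∈ Algebra.adjoin K {algebraMap R L θ} := hadj ▸ trivial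
    rw [Algebra.adjoin_singleton_eq_range_aeval] at hr
    obtain ⟨q, hq⟩ := hr
    obtain ⟨b, hb, hbq⟩ := IsLocalization.integerNormalization_spec A⁰ q
    refine ⟨b, nonZeroDivisors.ne_zero hb, IsLocalization.integerNormalization A⁰ q, hinj ?_⟩
    rw [← Polynomial.aeval_algebraMap_apply, ← Polynomial.aeval_map_algebraMap K, hbq,
      ← algebraMap_smul K b q, map_smul, algebraMap_smul]
    erw [hq]
    rw [Algebra.smul_def, Algebra.smul_def, map_mul, ← IsScalarTower.algebraMap_apply A R L]
  choose c hc p hp using hone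
  obtain ⟨S, hS⟩ := Module.Finite.fg_top (R := A) (M := R)
  refine ⟨θ, ∏ r ∈ S, c r, Finset.prod_ne_zero_iff.2 fun r _ ↦ hc r, fun r ↦ ?_, ?_⟩
  · have hr : r ∈ Submodule.span A (S : Set R) := hS ▸ trivial
    induction hr using Submodule.span_induction with
    | mem r hr =>
      obtain ⟨d, hd⟩ := Finset.dvd_prod_of_mem c hr
      exact ⟨d • p r, by rw [map_smul, hp, hd, smul_smul, mul_comm]⟩
    | zero => exact ⟨0, by simp⟩
    | add x y _ _ hx hy =>
      obtain ⟨u, hu⟩ := hx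
      obtain ⟨v, hv⟩ := hy
      exact ⟨u + v, by rw [map_add, hu, hv, smul_add]⟩
    | smul a x _ hx =>
      obtain ⟨u, hu⟩ := hx
      exact ⟨a • u, by rw [map_smul, hu, smul_comm]⟩
  · intro h
    have : CharZero K := charZero_of_injective_algebraMap (IsFractionRing.injective A K)
    refine Polynomial.Separable.aeval_derivative_ne_zero (S := L)
      (Algebra.IsSeparable.isSeparable K (algebraMap R L θ)) (minpoly.aeval K _) ?_
    rw [minpoly.isIntegrallyClosed_eq_field_fractions K L hint, Polynomial.derivative_map,
      Polynomial.aeval_map_algebraMap, Polynomial.aeval_algebraMap_apply, h, map_zero]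

/-- A ring homomorphism from the base extends along an extension generated, up to an element `c`
with invertible image, by one element `θ`, once a compatible image `t` of `θ` is given. -/
theorem exists_ringHom_extension {A R F : Type*} [CommRing A] [CommRing R] [Algebra A R] [Field F]
    (φ : A →+* F) (θ : R) (t : F) (c : A) (hc : φ c ≠ 0)
    (hgen : ∀ r : R, ∃ p : Polynomial A, Polynomial.aeval θ p = c • r)
    (hker : ∀ p : Polynomial A, Polynomial.aeval θ p = 0 → Polynomial.eval₂ φ t p = 0) :
    ∃ ψ : R →+* F, ψ.comp (algebraMap A R) = φ := by
  choose P hP using hgen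
  have key : ∀ p q : Polynomial A, Polynomial.aeval θ p = Polynomial.aeval θ q →
      Polynomial.eval₂ φ t p = Polynomial.eval₂ φ t q := fun p q h ↦ by
    rw [← sub_eq_zero, ← Polynomial.eval₂_sub]
    exact hker _ (by rw [map_sub, h, sub_self])
  have hscalar : ∀ a : A,
      Polynomial.eval₂ φ t (P (algebraMap A R a)) = φ c * φ a := fun a ↦ by
    rw [key _ (Polynomial.C (c * a)) (by rw [hP]; simp [Algebra.smul_def])]
    simp
  refine ⟨{ toFun := fun r ↦ Polynomial.eval₂ φ t (P r) / φ c
            map_one' := ?_, map_mul' := fun a b ↦ ?_, map_zero' := ?_, map_add' := fun a b ↦ ?_ },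
    RingHom.ext fun a ↦ ?_⟩
  · simpa [hc] using congrArg (· / φ c) (hscalar 1)
  · have := key (Polynomial.C c * P (a * b)) (P a * P b) (by
      simp only [map_mul, hP, Polynomial.aeval_C, Algebra.smul_def]; ring)
    rw [Polynomial.eval₂_mul, Polynomial.eval₂_mul, Polynomial.eval₂_C] at this
    field_simp
    linear_combination this
  · simpa [hc] using hscalar 0
  · rw [key (P (a + b)) (P a + P b) (by simp only [map_add, hP, smul_add]),
      Polynomial.eval₂_add, add_div]
  · simp [hscalar, hc]

open Filter Topology in
/-- A simple real root of a polynomial persists, as a root, under small perturbations of the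
parameters. -/
theorem eventually_exists_root_of_simple_root {d : ℕ}
    (m : Polynomial (MvPolynomial (Fin d) ℝ)) (x₀ : Fin d → ℝ) (t₀ : ℝ)
    (hroot : m.eval₂ (MvPolynomial.eval x₀) t₀ = 0)
    (hsimple : m.derivative.eval₂ (MvPolynomial.eval x₀) t₀ ≠ 0) :
    ∀ᶠ x in 𝓝 x₀, ∃ t, m.eval₂ (MvPolynomial.eval x) t = 0 := by
  wlog hpos : 0 < m.derivative.eval₂ (MvPolynomial.eval x₀) t₀ generalizing m
  · have := this (-m) (by simpa using hroot) (by simpa using hsimple)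
      (by simpa using lt_of_le_of_ne (not_lt.1 hpos) hsimple)
    simpa using this
  have hcont : ∀ t, Continuous fun x ↦ m.eval₂ (MvPolynomial.eval x) t := fun t ↦ by
    simp_rw [Polynomial.eval₂_eq_sum_range]
    exact continuous_finsetSum _ fun i _ ↦
      (MvPolynomial.continuous_eval _).mul continuous_const
  have hder : HasDerivAt (fun t ↦ m.eval₂ (MvPolynomial.eval x₀) t)
      (m.derivative.eval₂ (MvPolynomial.eval x₀) t₀) t₀ := by
    simpa only [Polynomial.eval₂_eq_eval_map, Polynomial.derivative_map] using
      (m.map (MvPolynomial.eval x₀)).hasDerivAt t₀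
  have hslope := (hasDerivAt_iff_tendsto_slope.1 hder).eventually (lt_mem_nhds hpos)
  have hright : ∃ t₂, 0 < m.eval₂ (MvPolynomial.eval x₀) t₂ := by
    obtain ⟨t, ht, hlt⟩ := ((hslope.filter_mono
      (nhdsWithin_mono t₀ (s := Set.Ioi t₀) fun t ht ↦ ne_of_gt ht)).and self_mem_nhdsWithin).exists
    refine ⟨t, ?_⟩
    rw [slope_def_field, hroot, sub_zero] at ht
    exact (div_pos_iff_of_pos_right (sub_pos.2 hlt)).1 ht
  have hleft : ∃ t₁, m.eval₂ (MvPolynomial.eval x₀) t₁ < 0 := by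
    obtain ⟨t, ht, hlt⟩ := ((hslope.filter_mono
      (nhdsWithin_mono t₀ (s := Set.Iio t₀) fun t ht ↦ ne_of_lt ht)).and self_mem_nhdsWithin).exists
    refine ⟨t, ?_⟩
    rw [slope_def_field, hroot, sub_zero] at ht
    exact (div_pos_iff.1 ht).elim (fun h ↦ absurd h.2 (sub_neg.2 hlt).not_gt) And.left
  obtain ⟨t₂, ht₂⟩ := hright
  obtain ⟨t₁, ht₁⟩ := hleft
  filter_upwards [(hcont t₂).continuousAt.eventually (lt_mem_nhds ht₂),
    (hcont t₁).continuousAt.eventually (gt_mem_nhds ht₁)] with x h₂ h₁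
  have hcont' : Continuous fun t ↦ m.eval₂ (MvPolynomial.eval x) t := by
    simp_rw [Polynomial.eval₂_eq_eval_map]
    exact Polynomial.continuous _
  exact mem_range_of_exists_le_of_exists_ge hcont' ⟨t₁, h₁.le⟩ ⟨t₂, h₂.le⟩

/-- The non-vanishing locus of a nonzero real polynomial is dense. -/
theorem MvPolynomial.dense_setOf_eval_ne_zero {ι : Type*} [Finite ι]
    {g : MvPolynomial ι ℝ} (hg : g ≠ 0) :
    Dense {x : ι → ℝ | eval x g ≠ 0} := by
  have := Fintype.ofFinite ι
  refine Metric.dense_iff.2 fun x r hr ↦ ?_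
  by_contra hempty
  refine hg (funext_set (fun i ↦ Metric.ball (x i) r) (fun i ↦ ?_) fun y hy ↦ ?_)
  · rw [Real.ball_eq_Ioo]
    exact Set.Ioo_infinite (by linarith)
  · by_contra hne
    rw [map_zero] at hne
    exact hempty ⟨y, by rwa [ball_pi _ hr], hne⟩

open Filter Topology in
/-- If the real points of a finitely generated real domain `R` separate nonzero elements from zero,
then countably many nonzero elements are simultaneously nonzero at some real point. -/
theorem exists_algHom_forall_ne_zero {R : Type*} [CommRing R] [IsDomain R] [Algebra ℝ R]
    [Algebra.FiniteType ℝ R] (hreal : ∀ f : R, f ≠ 0 → ∃ φ : R →ₐ[ℝ] ℝ, φ f ≠ 0)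
    (f : ℕ → R) (hf : ∀ i, f i ≠ 0) : ∃ φ : R →ₐ[ℝ] ℝ, ∀ i, φ (f i) ≠ 0 := by
  obtain ⟨d, g, hinj, hfin⟩ := exists_finite_inj_algHom_of_fg ℝ R
  let := g.toRingHom.toAlgebra
  have : IsScalarTower ℝ (MvPolynomial (Fin d) ℝ) R :=
    .of_algebraMap_eq fun r ↦ (g.commutes r).symm
  have : Module.Finite (MvPolynomial (Fin d) ℝ) R := hfin
  have : FaithfulSMul (MvPolynomial (Fin d) ℝ) R :=
    (faithfulSMul_iff_algebraMap_injective _ _).2 hinj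
  obtain ⟨θ, c, hc, hgen, hder⟩ := exists_almost_primitive_element (MvPolynomial (Fin d) ℝ) R
  have hc' : algebraMap (MvPolynomial (Fin d) ℝ) R c ≠ 0 := by
    rwa [ne_eq, FaithfulSMul.algebraMap_eq_zero_iff]
  obtain ⟨φ₀, hφ₀⟩ := hreal _ (mul_ne_zero hc' hder)
  rw [map_mul] at hφ₀
  let x₀ : Fin d → ℝ := fun i ↦ φ₀ (algebraMap (MvPolynomial (Fin d) ℝ) R (MvPolynomial.X i))
  have hx₀ : (φ₀ : R →+* ℝ).comp (algebraMap (MvPolynomial (Fin d) ℝ) R) =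
      MvPolynomial.eval x₀ := by
    refine MvPolynomial.ringHom_ext (fun r ↦ ?_) fun i ↦ by simp [x₀]
    rw [← MvPolynomial.algebraMap_eq, RingHom.comp_apply, ← IsScalarTower.algebraMap_apply]
    simp
  have heval : ∀ p : Polynomial (MvPolynomial (Fin d) ℝ),
      φ₀ (Polynomial.aeval θ p) = p.eval₂ (MvPolynomial.eval x₀) (φ₀ θ) := fun p ↦ by
    rw [← hx₀, Polynomial.aeval_def]
    exact Polynomial.hom_eval₂ p _ (φ₀ : R →+* ℝ) θ
  have hnear : ∀ᶠ x in 𝓝 x₀, MvPolynomial.eval x c ≠ 0 ∧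
      ∃ t, (minpoly _ θ).eval₂ (MvPolynomial.eval x) t = 0 := by
    refine ((MvPolynomial.continuous_eval c).continuousAt.eventually_ne ?_).and
      (eventually_exists_root_of_simple_root _ x₀ (φ₀ θ) ?_ ?_)
    · rw [← hx₀]
      exact left_ne_zero_of_mul hφ₀
    · rw [← heval, minpoly.aeval, map_zero]
    · rw [← heval]
      exact right_ne_zero_of_mul hφ₀
  have hdvd : ∀ i, ∃ b : MvPolynomial (Fin d) ℝ,
      b ≠ 0 ∧ f i ∣ algebraMap (MvPolynomial (Fin d) ℝ) R b := fun i ↦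
    (Algebra.IsAlgebraic.isAlgebraic (f i)).exists_nonzero_dvd
      (mem_nonZeroDivisors_of_ne_zero (hf i))
  choose b hb hfb using hdvd
  have hdense := dense_iInter_of_isOpen
    (fun i ↦ isOpen_ne_fun (MvPolynomial.continuous_eval (b i)) continuous_const)
    fun i ↦ MvPolynomial.dense_setOf_eval_ne_zero (hb i)
  obtain ⟨x, hbx, hcx, t, ht⟩ := hdense.inter_nhds_nonempty hnear
  obtain ⟨ψ, hψ⟩ := exists_ringHom_extension (MvPolynomial.eval x) θ t c hcx hgen fun p hp ↦
    Polynomial.eval₂_eq_zero_of_dvd_of_eval₂_eq_zero _ _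
      (minpoly.isIntegrallyClosed_dvd (Algebra.IsIntegral.isIntegral θ) hp) ht
  have hψℝ : ψ.comp (algebraMap ℝ R) = RingHom.id ℝ := Subsingleton.elim _ _
  refine ⟨{ ψ with commutes' := RingHom.congr_fun hψℝ }, fun i hi ↦ ?_⟩
  refine Set.mem_iInter.1 hbx i ?_
  rw [← hψ, RingHom.comp_apply]
  exact zero_dvd_iff.1 ((show ψ (f i) = 0 from hi) ▸ map_dvd ψ (hfb i))


/-- An algebraic subset of ℝ^n: the common zero set of a family of real
polynomials in n variables. -/
def IsAlgebraicSet (n : ℕ) (A : Set (Fin n → ℝ)) : Prop :=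
  ∃ S : Set (MvPolynomial (Fin n) ℝ), A = {x | ∀ p ∈ S, MvPolynomial.eval x p = 0}

/-- An irreducible algebraic set: nonempty and not the union of two properly
smaller algebraic sets. -/
def IsIrreducibleAlg (n : ℕ) (A : Set (Fin n → ℝ)) : Prop :=
  A.Nonempty ∧ IsAlgebraicSet n A ∧
    ∀ C D : Set (Fin n → ℝ), IsAlgebraicSet n C → IsAlgebraicSet n D →
      A = C ∪ D → A = C ∨ A = D

/-- If an irreducible algebraic set A ⊆ ℝ^n is covered by countably many algebraic
sets, then it is contained in one of them. -/
theorem irreducible_algebraic_countable_cover (n : ℕ) (A : Set (Fin n → ℝ))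
    (B : ℕ → Set (Fin n → ℝ))
    (hA : IsIrreducibleAlg n A)
    (hB : ∀ i, IsAlgebraicSet n (B i))
    (hcov : A ⊆ ⋃ i, B i) :
    ∃ i, A ⊆ B i := by
  obtain ⟨⟨a, ha⟩, ⟨S, hS⟩, hirr⟩ := hA
  by_contra! hnot
  let I := MvPolynomial.vanishingIdeal ℝ A
  have hmem : ∀ p, p ∈ I ↔ ∀ x ∈ A, MvPolynomial.eval x p = 0 := fun p ↦ Iff.rfl
  have hsection : ∀ p, IsAlgebraicSet n (A ∩ {x | MvPolynomial.eval x p = 0}) := fun p ↦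
    ⟨insert p S, by ext x; simp [hS, and_comm]⟩
  have hprime : I.IsPrime := by
    refine ⟨fun h ↦ by simpa using (hmem 1).1 (h ▸ trivial) a ha, fun {p q} hpq ↦ ?_⟩
    have hunion : A = A ∩ {x | MvPolynomial.eval x p = 0} ∪ A ∩ {x | MvPolynomial.eval x q = 0} := by
      rw [← Set.inter_union_distrib_left]
      refine (Set.inter_eq_left.2 fun x hx ↦ ?_).symm
      simpa using (hmem _).1 hpq x hx
    refine (hirr _ _ (hsection p) (hsection q) hunion).imp (fun h x hx ↦ ?_) fun h x hx ↦ ?_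
    all_goals
      rw [h] at hx
      exact hx.2
  have hsep : ∀ i, ∃ p : MvPolynomial (Fin n) ℝ, (∀ x ∈ B i, MvPolynomial.eval x p = 0) ∧ p ∉ I := by
    intro i
    obtain ⟨T, hT⟩ := hB i
    obtain ⟨x, hxA, hxB⟩ := Set.not_subset.1 (hnot i)
    rw [hT] at hxB
    simp only [Set.mem_ofPred_eq, not_forall] at hxB
    obtain ⟨p, hp, hpx⟩ := hxB
    exact ⟨p, fun y hy ↦ (hT.subset hy :) p hp, fun h ↦ hpx ((hmem p).1 h x hxA)⟩
  choose p hpB hpI using hsep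
  obtain ⟨φ, hφ⟩ := exists_algHom_forall_ne_zero (R := MvPolynomial (Fin n) ℝ ⧸ I)
    (fun f hf ↦ by
      obtain ⟨q, rfl⟩ := Ideal.Quotient.mk_surjective f
      rw [ne_eq, Ideal.Quotient.eq_zero_iff_mem, hmem] at hf
      push Not at hf
      obtain ⟨x, hx, hqx⟩ := hf
      exact ⟨Ideal.Quotient.liftₐ I (MvPolynomial.aeval x) fun r hr ↦ (hmem r).1 hr x hx, hqx⟩)
    (fun i ↦ Ideal.Quotient.mk I (p i)) fun i ↦ by
      rw [ne_eq, Ideal.Quotient.eq_zero_iff_mem]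
      exact hpI i
  let x : Fin n → ℝ := fun j ↦ φ (Ideal.Quotient.mk I (MvPolynomial.X j))
  have hφx : ∀ q, φ (Ideal.Quotient.mk I q) = MvPolynomial.eval x q := fun q ↦
    DFunLike.congr_fun (MvPolynomial.algHom_ext (f := φ.comp (Ideal.Quotient.mkₐ ℝ I))
      (g := MvPolynomial.aeval x) fun j ↦ by simp [x]) q
  have hxA : x ∈ A := by
    rw [hS]
    intro q hq
    have hqI : q ∈ I := (hmem q).2 fun y hy ↦ by
      rw [hS] at hy
      exact hy q hq
    rw [← hφx, Ideal.Quotient.eq_zero_iff_mem.2 hqI, map_zero]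
  obtain ⟨i, hi⟩ := Set.mem_iUnion.1 (hcov hxA)
  exact hφ i ((hφx _).trans (hpB i x hi))
end

section
/- Let F be a real closed subfield of ℝ, let A ⊆ ℝ^m and B ⊆ ℝ^n × ℝ^m be algebraic sets defined by polynomials with coefficients in F. Then C = {x ∈ ℝ^n : ∀ y ∈ A, (x,y) ∈ B} is an algebraic set definable by a polynomial with coefficients in F. -/
/-- A subfield F ⊆ ℝ is real closed if nonnegative elements have square roots in F
and every odd-degree polynomial with coefficients in F has a root in F. -/
def IsRealClosedSubfield (F : Subfield ℝ) : Prop :=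
  (∀ x : ℝ, x ∈ F → 0 ≤ x → ∃ y ∈ F, y ^ 2 = x) ∧
  ∀ p : Polynomial ℝ, p ≠ 0 → (∀ i, p.coeff i ∈ F) → Odd p.natDegree →
    ∃ x ∈ F, Polynomial.eval x p = 0

open Polynomial IntermediateField in
/-- If every polynomial of odd degree over `k` has a root, every finite Galois extension of `k`
has degree a power of two. -/
theorem exists_finrank_eq_two_pow {k N : Type*} [Field k] [Field N] [Algebra k N]
    (hodd : ∀ f : k[X], Odd f.natDegree → ∃ x, f.IsRoot x)
    [FiniteDimensional k N] [IsGalois k N] : ∃ n, Module.finrank k N = 2 ^ n := by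
  obtain ⟨n, l, hl, hn⟩ := Nat.exists_eq_two_pow_mul_odd (Module.finrank_pos (R := k) (M := N)).ne'
  have : Fact (Nat.Prime 2) := ⟨Nat.prime_two⟩
  obtain ⟨P, hP⟩ := Sylow.exists_subgroup_card_pow_prime (G := Gal(N/k)) 2 (n := n)
    (by rw [IsGalois.card_aut_eq_finrank, hn]; exact dvd_mul_right _ _)
  have h1 := finrank_fixedField_eq_card P
  have h2 := Module.finrank_mul_finrank k (fixedField P) N
  have h3 : Module.finrank k (fixedField P) = l := by
    rw [h1, hP, hn, mul_comm] at h2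
    exact Nat.eq_of_mul_eq_mul_left (by positivity) h2
  obtain ⟨α, hα⟩ := Field.exists_primitive_element k (fixedField P)
  have hd := (Field.primitive_element_iff_minpoly_natDegree_eq k α).1 hα
  obtain ⟨x, hx⟩ := hodd (minpoly k α) (by rwa [hd, h3])
  have hone := natDegree_eq_of_degree_eq_some
    (degree_eq_one_of_irreducible_of_root
      (minpoly.irreducible (Algebra.IsIntegral.isIntegral (R := k) α)) hx)
  refine ⟨n, ?_⟩
  rw [hn, ← h3, ← hd, hone]
  exact mul_one _

open Polynomial IntermediateField in
/-- If every polynomial of odd degree over `k` has a root, every proper algebraic extension of `k`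
contains a quadratic element. -/
theorem exists_natDegree_minpoly_eq_two {k L : Type*} [Field k] [CharZero k] [Field L] [Algebra k L]
    (hodd : ∀ f : k[X], Odd f.natDegree → ∃ x, f.IsRoot x)
    {a : L} (ha : IsIntegral k a) (hak : a ∉ Set.range (algebraMap k L)) :
    ∃ e : L, IsIntegral k e ∧ (minpoly k e).natDegree = 2 := by
  let N := (minpoly k a).SplittingField
  have : IsGalois k N := IsGalois.of_separable_splitting_field
    (minpoly.irreducible ha).separable
  obtain ⟨b, hb⟩ : ∃ b : N, aeval b (minpoly k a) = 0 := by
    obtain ⟨b, hb⟩ := (SplittingField.splits (minpoly k a)).exists_eval_eq_zero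
      (by rw [degree_map]; exact (minpoly.degree_pos ha).ne')
    exact ⟨b, by rwa [eval_map_algebraMap] at hb⟩
  have hmin : minpoly k a = minpoly k b :=
    minpoly.eq_of_irreducible_of_monic (minpoly.irreducible ha) hb (minpoly.monic ha)
  have hbi : IsIntegral k b := ⟨minpoly k a, minpoly.monic ha, hb⟩
  have : Fact (Nat.Prime 2) := ⟨Nat.prime_two⟩
  obtain ⟨n, hn⟩ := exists_finrank_eq_two_pow (N := N) hodd
  obtain ⟨i, hin, hi⟩ := (Nat.dvd_prime_pow Nat.prime_two).1
    (hn ▸ Dvd.intro_left _ (Module.finrank_mul_finrank k k⟮b⟯ N))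
  have hne : i ≠ n := by
    rintro rfl
    have h := Module.finrank_mul_finrank k k⟮b⟯ N
    rw [hn, hi] at h
    have h1 : Module.finrank k k⟮b⟯ = 1 :=
      Nat.eq_of_mul_eq_mul_right (Nat.two_pow_pos i) (h.trans (one_mul _).symm)
    rw [adjoin.finrank hbi, ← hmin, minpoly.natDegree_eq_one_iff] at h1
    exact hak h1
  obtain ⟨H, hH, hle⟩ := Sylow.exists_subgroup_card_pow_prime_le (G := Gal(N/k)) 2 (m := n - 1)
    (by rw [IsGalois.card_aut_eq_finrank, hn]; exact pow_dvd_pow _ (by omega))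
    k⟮b⟯.fixingSubgroup (by rw [IsGalois.card_fixingSubgroup_eq_finrank, hi]) (by omega)
  have hEle : fixedField H ≤ k⟮b⟯ := by
    simpa [IsGalois.fixedField_fixingSubgroup] using fixedField_le hle
  have h2 : Module.finrank k (fixedField H) = 2 := by
    have h := Module.finrank_mul_finrank k (fixedField H) N
    rw [finrank_fixedField_eq_card, hH, hn] at h
    obtain ⟨j, rfl⟩ : ∃ j, n = j + 1 := ⟨n - 1, by omega⟩
    rw [pow_succ', Nat.add_sub_cancel] at h
    exact Nat.eq_of_mul_eq_mul_right (by positivity) h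
  obtain ⟨e, he⟩ := Field.exists_primitive_element k (fixedField H)
  have hed := (Field.primitive_element_iff_minpoly_natDegree_eq k e).1 he
  let φ : k⟮b⟯ →ₐ[k] L := (algHomAdjoinIntegralEquiv k hbi).symm
    ⟨a, by rw [mem_aroots, ← hmin]; exact ⟨minpoly.ne_zero ha, minpoly.aeval k a⟩⟩
  let ψ : fixedField H →ₐ[k] L := φ.comp (inclusion hEle)
  exact ⟨ψ e, (Algebra.IsIntegral.isIntegral e).map ψ, by
    rw [minpoly.algHom_eq ψ ψ.injective, hed, h2]⟩

open Polynomial in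
theorem IsRealClosedSubfield.exists_isRoot_of_odd {F : Subfield ℝ} (hF : IsRealClosedSubfield F)
    (f : F[X]) (hf : Odd f.natDegree) : ∃ x, f.IsRoot x := by
  have h0 : f ≠ 0 := by rintro rfl; simp at hf
  obtain ⟨x, hx, hfx⟩ := hF.2 (f.map F.subtype)
    ((Polynomial.map_ne_zero_iff F.subtype.injective).2 h0) (fun i => by simp)
    (by rwa [natDegree_map])
  refine ⟨⟨x, hx⟩, ?_⟩
  rw [IsRoot, ← map_eq_zero_iff F.subtype F.subtype.injective, ← eval₂_at_apply, ← eval_map]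
  exact hfx

open Polynomial in
/-- A real closed subfield of `ℝ` is relatively algebraically closed in `ℝ`. -/
theorem IsRealClosedSubfield.mem_of_isIntegral {F : Subfield ℝ} (hF : IsRealClosedSubfield F)
    {a : ℝ} (ha : IsIntegral F a) : a ∈ F := by
  by_contra haF
  obtain ⟨e, he, hd⟩ := exists_natDegree_minpoly_eq_two hF.exists_isRoot_of_odd ha
    (by rintro ⟨x, rfl⟩; exact haF x.2)
  have hq := minpoly.aeval F e
  have hm := (minpoly.monic he).coeff_natDegree
  rw [hd] at hm
  rw [aeval_eq_sum_range, hd] at hq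
  simp only [Finset.sum_range_succ, Finset.sum_range_zero, hm, Algebra.smul_def] at hq
  set b : F := (minpoly F e).coeff 1
  set c : F := (minpoly F e).coeff 0
  have hq' : (c : ℝ) + b * e + e ^ 2 = 0 := by
    simpa [Algebra.algebraMap_eq_smul_one, Subfield.smul_def] using hq
  have hsq : (2 * e + b) ^ 2 = (b : ℝ) ^ 2 - 4 * c := by linear_combination 4 * hq'
  obtain ⟨y, hy, hyy⟩ := hF.1 ((b : ℝ) ^ 2 - 4 * c) (b ^ 2 - 4 * c : F).2
    (hsq ▸ sq_nonneg _)
  have heF : e ∈ F := by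
    have h2 : (2 : ℝ) ∈ F := (2 : F).2
    rcases sq_eq_sq_iff_eq_or_eq_neg.1 (hsq.trans hyy.symm) with h | h
    · have : e = (y - b) / 2 := by linarith
      rw [this]; exact F.div_mem (F.sub_mem hy b.2) h2
    · have : e = (-y - b) / 2 := by linarith
      rw [this]; exact F.div_mem (F.sub_mem (F.neg_mem hy) b.2) h2
  have := (minpoly.natDegree_eq_one_iff (A := F) (x := e)).2 ⟨⟨e, heF⟩, rfl⟩
  omega

open Polynomial in
/-- The intermediate value property for polynomials over a real closed subfield of `ℝ`. -/
theorem IsRealClosedSubfield.exists_isRoot_of_eval_mul_neg {F : Subfield ℝ}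
    (hF : IsRealClosedSubfield F) {f : F[X]} {u v : F} (huv : u ≤ v)
    (hf : (f.eval u * f.eval v : F) < 0) : ∃ x : F, x ∈ Set.Icc u v ∧ f.IsRoot x := by
  have hev (x : F) : aeval (x : ℝ) f = (f.eval x : F) :=
    aeval_algebraMap_apply_eq_algebraMap_eval x f
  have hcont : ContinuousOn (fun x : ℝ => aeval x f) (Set.uIcc (u : ℝ) v) :=
    (Polynomial.continuous_aeval f).continuousOn
  obtain ⟨x, hx, hx0⟩ := intermediate_value_uIcc hcont (show (0 : ℝ) ∈ _ by
    rw [Set.mem_uIcc, hev, hev]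
    rcases mul_neg_iff.1 hf with h | h
    · exact .inr ⟨by exact_mod_cast h.2.le, by exact_mod_cast h.1.le⟩
    · exact .inl ⟨by exact_mod_cast h.1.le, by exact_mod_cast h.2.le⟩)
  rw [Set.uIcc_of_le (by exact_mod_cast huv)] at hx
  have h0 : f ≠ 0 := by rintro rfl; simp at hf
  have hxF : x ∈ F := hF.mem_of_isIntegral (isAlgebraic_iff_isIntegral.1 ⟨f, h0, hx0⟩)
  refine ⟨⟨x, hxF⟩, ⟨hx.1, hx.2⟩, ?_⟩
  have := hev ⟨x, hxF⟩
  simpa [hx0] using this.symm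

open Polynomial Filter Topology in
/-- Near a simple zero, a real polynomial changes sign. -/
theorem exists_rat_eval_mul_eval_neg {f : ℝ[X]} {a : ℝ} (h0 : f.eval a = 0)
    (h1 : f.derivative.eval a ≠ 0) {ε : ℝ} (hε : 0 < ε) :
    ∃ u v : ℚ, a - ε < u ∧ (u : ℝ) ≤ v ∧ v < a + ε ∧ f.eval (u : ℝ) * f.eval (v : ℝ) < 0 := by
  have hs := (hasDerivAt_iff_tendsto_slope.1 (f.hasDerivAt a)).mul_const (f.derivative.eval a)
  have hev := hs.eventually_const_lt (mul_self_pos.2 h1)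
  rw [eventually_nhdsWithin_iff, Metric.eventually_nhds_iff] at hev
  obtain ⟨δ, hδ, hev⟩ := hev
  obtain ⟨u, hu1, hu2⟩ := exists_rat_btwn (show a - min δ ε < a by simp [hδ, hε])
  obtain ⟨v, hv1, hv2⟩ := exists_rat_btwn (show a < a + min δ ε by simp [hδ, hε])
  have hmd := min_le_left δ ε
  have hme := min_le_right δ ε
  have hu := hev (y := u) (by rw [Real.dist_eq, abs_lt]; constructor <;> linarith) hu2.ne
  have hv := hev (y := v) (by rw [Real.dist_eq, abs_lt]; constructor <;> linarith) hv1.ne'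
  refine ⟨u, v, by linarith, by linarith, by linarith, ?_⟩
  rw [slope_def_field, h0, sub_zero] at hu hv
  have hu' : f.eval (u : ℝ) * f.derivative.eval a < 0 := by
    rw [div_mul_eq_mul_div] at hu
    rcases div_pos_iff.1 hu with h | h
    · linarith [h.2]
    · exact h.1
  have hv' : 0 < f.eval (v : ℝ) * f.derivative.eval a := by
    rw [div_mul_eq_mul_div] at hv
    rcases div_pos_iff.1 hv with h | h
    · exact h.1
    · linarith [h.2]
  have := mul_neg_of_neg_of_pos hu' hv'
  have hsq := mul_self_pos.2 h1
  by_contra! hcon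
  nlinarith [mul_nonneg hcon hsq.le]

namespace Filter.Germ

open Filter Topology

variable {F : Subfield ℝ} {U : Ultrafilter ℕ}

/-- The germ `g` of a sequence in `F` converges to the real number `x`. -/
def ConvergesTo (g : Germ (U : Filter ℕ) F) (x : ℝ) : Prop :=
  g.Tendsto (comap ((↑) : F → ℝ) (𝓝 x))

theorem convergesTo_coe {f : ℕ → F} {x : ℝ} :
    ConvergesTo (f : Germ (U : Filter ℕ) F) x ↔ Tendsto (fun n => (f n : ℝ)) U (𝓝 x) :=
  tendsto_comap_iff

theorem ConvergesTo.unique {g : Germ (U : Filter ℕ) F} {x y : ℝ} (hx : ConvergesTo g x)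
    (hy : ConvergesTo g y) : x = y := by
  induction g using Germ.inductionOn with | _ f =>
  exact tendsto_nhds_unique (convergesTo_coe.1 hx) (convergesTo_coe.1 hy)

theorem convergesTo_const (c : F) : ConvergesTo (↑c : Germ (U : Filter ℕ) F) c :=
  convergesTo_coe.2 tendsto_const_nhds

theorem ConvergesTo.add {g h : Germ (U : Filter ℕ) F} {x y : ℝ} (hx : ConvergesTo g x)
    (hy : ConvergesTo h y) : ConvergesTo (g + h) (x + y) := by
  induction g using Germ.inductionOn with | _ g =>
  induction h using Germ.inductionOn with | _ h =>
  exact convergesTo_coe.2 ((convergesTo_coe.1 hx).add (convergesTo_coe.1 hy))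

theorem ConvergesTo.mul {g h : Germ (U : Filter ℕ) F} {x y : ℝ} (hx : ConvergesTo g x)
    (hy : ConvergesTo h y) : ConvergesTo (g * h) (x * y) := by
  induction g using Germ.inductionOn with | _ g =>
  induction h using Germ.inductionOn with | _ h =>
  exact convergesTo_coe.2 ((convergesTo_coe.1 hx).mul (convergesTo_coe.1 hy))

theorem ConvergesTo.inv {g : Germ (U : Filter ℕ) F} {x : ℝ} (hx : ConvergesTo g x)
    (h0 : x ≠ 0) : ConvergesTo g⁻¹ x⁻¹ := by
  induction g using Germ.inductionOn with | _ g =>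
  exact convergesTo_coe.2 ((convergesTo_coe.1 hx).inv₀ h0)

theorem exists_convergesTo (F : Subfield ℝ) {U : Ultrafilter ℕ} (hU : (U : Filter ℕ) ≤ atTop)
    (a : ℝ) : ∃ g : Germ (U : Filter ℕ) F, ConvergesTo g a := by
  obtain ⟨u, hu⟩ := mem_closure_iff_seq_limit.1 (Rat.isDenseEmbedding_coe_real.dense a)
  choose r hr using hu.1
  refine ⟨((fun n => (r n : F) : ℕ → F) : Germ (U : Filter ℕ) F), convergesTo_coe.2 ?_⟩
  simpa [hr] using hu.2.mono_left hU

end Filter.Germ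

open Filter Topology Filter.Germ Polynomial IntermediateField

section

variable {L E K : Type*} [Field L] [Field E] [Field K] [Algebra L E] (σ : L →+* K) {a : E} {g : K}

theorem exists_ringHom_adjoin_of_isIntegral (ha : IsIntegral L a)
    (hg : (minpoly L a).eval₂ σ g = 0) :
    ∃ τ : L⟮a⟯ →+* K, (∀ x, τ (algebraMap L L⟮a⟯ x) = σ x) ∧ τ (AdjoinSimple.gen L a) = g := by
  let : Algebra L K := σ.toAlgebra
  let τ : L⟮a⟯ →ₐ[L] K :=
    (algHomAdjoinIntegralEquiv L ha).symm ⟨g, mem_aroots.2 ⟨minpoly.ne_zero ha, hg⟩⟩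
  exact ⟨τ, τ.commutes, algHomAdjoinIntegralEquiv_symm_apply_gen _ _ _⟩

theorem exists_ringHom_adjoin_of_transcendental (ha : Transcendental L a)
    (hg : ∀ f : L[X], f.eval₂ σ g = 0 → f = 0) :
    ∃ τ : L⟮a⟯ →+* K, (∀ x, τ (algebraMap L L⟮a⟯ x) = σ x) ∧ τ (AdjoinSimple.gen L a) = g := by
  let : Algebra L K := σ.toAlgebra
  have hinj : Function.Injective (aeval g : L[X] →ₐ[L] K) :=
    (injective_iff_map_eq_zero _).2 hg
  let τ : L⟮a⟯ →ₐ[L] K := (RatFunc.liftAlgHom (aeval g)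
    (nonZeroDivisors_le_comap_nonZeroDivisors_of_injective _ hinj)).comp
      (RatFunc.algEquivOfTranscendental a ha).symm.toAlgHom
  refine ⟨τ, τ.commutes, ?_⟩
  have h : RatFunc.liftAlgHom (aeval g : L[X] →ₐ[L] K)
      (nonZeroDivisors_le_comap_nonZeroDivisors_of_injective _ hinj)
      (algebraMap L[X] (RatFunc L) X) = g := by
    rw [RatFunc.liftAlgHom_apply]
    simp
  simpa [τ, ← RatFunc.algebraMap_X] using h

end

section

variable {F : Subfield ℝ} {U : Ultrafilter ℕ} {L : IntermediateField F ℝ}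
  {σ : L →+* Germ (U : Filter ℕ) F}

theorem convergesTo_eval₂ (hσ : ∀ x, ConvergesTo (σ x) x) {g : Germ (U : Filter ℕ) F} {a : ℝ}
    (hg : ConvergesTo g a) (f : L[X]) : ConvergesTo (f.eval₂ σ g) (aeval a f) := by
  induction f using Polynomial.induction_on with
  | C c => simpa using hσ c
  | add p q hp hq => simpa [eval₂_add] using hp.add hq
  | monomial n c h => simpa [eval₂_mul, pow_succ, ← mul_assoc] using h.mul hg

theorem exists_seq_polynomial (σ : L →+* Germ (U : Filter ℕ) F) (f : L[X]) :
    ∃ M : ℕ → F[X], ∀ h : ℕ → F,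
      f.eval₂ σ (h : Germ (U : Filter ℕ) F) = ((fun n => (M n).eval (h n) : ℕ → F) : Germ _ F) := by
  induction f using Polynomial.induction_on' with
  | add p q hp hq =>
    obtain ⟨M, hM⟩ := hp
    obtain ⟨N, hN⟩ := hq
    refine ⟨fun n => M n + N n, fun h => ?_⟩
    simp only [eval₂_add, hM, hN, eval_add]
    rfl
  | monomial k c =>
    obtain ⟨r, hr⟩ : ∃ r : ℕ → F, (r : Germ (U : Filter ℕ) F) = σ c := Quotient.exists_rep (σ c)
    refine ⟨fun n => monomial k (r n), fun h => ?_⟩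
    simp only [eval₂_monomial, eval_monomial, ← hr]
    rfl

theorem exists_eval₂_minpoly_eq_zero (hF : IsRealClosedSubfield F)
    (hσ : ∀ x, ConvergesTo (σ x) x) {a : ℝ} (ha : IsIntegral L a) :
    ∃ g : Germ (U : Filter ℕ) F, (minpoly L a).eval₂ σ g = 0 ∧ ConvergesTo g a := by
  obtain ⟨M, hM⟩ := exists_seq_polynomial σ (minpoly L a)
  have key (ε : ℝ) (hε : 0 < ε) :
      ∀ᶠ n in (U : Filter ℕ), M n ≠ 0 ∧ ∃ x : F, (M n).IsRoot x ∧ |(x : ℝ) - a| < ε := by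
    obtain ⟨u, v, hu, huv, hv, hneg⟩ := exists_rat_eval_mul_eval_neg
      (f := (minpoly L a).map (algebraMap L ℝ)) (a := a)
      (by rw [eval_map_algebraMap, minpoly.aeval])
      (by
        rw [derivative_map, eval_map_algebraMap]
        exact (minpoly.irreducible ha).separable.aeval_derivative_ne_zero (minpoly.aeval L a)) hε
    rw [eval_map_algebraMap, eval_map_algebraMap] at hneg
    have hlim (w : ℚ) :
        Tendsto (fun n => (((M n).eval (w : F) : F) : ℝ)) U (𝓝 (aeval (w : ℝ) (minpoly L a))) := by
      rw [← convergesTo_coe, ← hM fun _ => (w : F)]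
      exact convergesTo_eval₂ hσ (convergesTo_coe.2 (by simp)) _
    filter_upwards [((hlim u).mul (hlim v)).eventually_lt_const hneg] with n hn
    have hn' : (M n).eval (u : F) * (M n).eval (v : F) < 0 := by exact_mod_cast hn
    refine ⟨by rintro h; simp [h] at hn', ?_⟩
    obtain ⟨x, ⟨hux, hxv⟩, hx⟩ := hF.exists_isRoot_of_eval_mul_neg
      (show (u : F) ≤ v by exact_mod_cast huv) hn'
    have hux' : (u : ℝ) ≤ x := by exact_mod_cast hux
    have hxv' : (x : ℝ) ≤ v := by exact_mod_cast hxv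
    exact ⟨x, hx, by rw [abs_lt]; constructor <;> linarith⟩
  have hroot (n : ℕ) : ∃ z : F, M n ≠ 0 → ∀ x : F, (M n).IsRoot x →
      (M n).IsRoot z ∧ |(z : ℝ) - a| ≤ |(x : ℝ) - a| := by
    by_cases h : M n ≠ 0 ∧ ∃ x, (M n).IsRoot x
    · obtain ⟨h0, x, hx⟩ := h
      obtain ⟨z, hz, hmin⟩ := (M n).roots.toFinset.exists_min_image (fun z => |(z : ℝ) - a|)
        ⟨x, by simpa [h0] using hx⟩
      refine ⟨z, fun _ y hy => ⟨by simpa [h0] using hz, hmin y (by simpa [h0] using hy)⟩⟩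
    · exact ⟨0, fun h0 x hx => (h ⟨h0, x, hx⟩).elim⟩
  choose z hz using hroot
  refine ⟨z, ?_, convergesTo_coe.2 (Metric.tendsto_nhds.2 fun ε hε => ?_)⟩
  · rw [hM]
    refine Germ.coe_eq.2 ?_
    filter_upwards [key 1 one_pos] with n hn
    obtain ⟨h0, x, hx, -⟩ := hn
    exact (hz n h0 x hx).1
  · filter_upwards [key ε hε] with n hn
    obtain ⟨h0, x, hx, hxa⟩ := hn
    exact (hz n h0 x hx).2.trans_lt hxa

/-- An embedding of `L` into an ultrapower of `F` compatible with limits extends to `L⟮a⟯`. -/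
theorem exists_extension_convergesTo (hF : IsRealClosedSubfield F)
    (hU : (U : Filter ℕ) ≤ atTop) (hσ : ∀ x, ConvergesTo (σ x) x) (a : ℝ) :
    ∃ τ : L⟮a⟯ →+* Germ (U : Filter ℕ) F,
      (∀ x : L, τ (algebraMap L L⟮a⟯ x) = σ x) ∧ ∀ x, ConvergesTo (τ x) x := by
  obtain ⟨τ, hτσ, hτ⟩ : ∃ τ : L⟮a⟯ →+* Germ (U : Filter ℕ) F,
      (∀ x, τ (algebraMap L L⟮a⟯ x) = σ x) ∧ ConvergesTo (τ (AdjoinSimple.gen L a)) a := by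
    by_cases ha : IsIntegral L a
    · obtain ⟨g, hg, hga⟩ := exists_eval₂_minpoly_eq_zero hF hσ ha
      obtain ⟨τ, hτ, rfl⟩ := exists_ringHom_adjoin_of_isIntegral σ ha hg
      exact ⟨τ, hτ, hga⟩
    · have htr : Transcendental L a := fun h => ha h.isIntegral
      obtain ⟨g, hg⟩ := exists_convergesTo F hU a
      obtain ⟨τ, hτ, rfl⟩ := exists_ringHom_adjoin_of_transcendental σ htr (g := g) fun f hf => by
        have h := convergesTo_eval₂ hσ hg f
        have h' : f.eval₂ σ g = ((0 : F) : Germ (U : Filter ℕ) F) := hf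
        rw [h'] at h
        have h0 : aeval a f = 0 := h.unique (convergesTo_const (0 : F))
        by_contra hne
        exact htr ⟨f, hne, h0⟩
      exact ⟨τ, hτ, hg⟩
  refine ⟨τ, hτσ, fun x => ?_⟩
  obtain ⟨x, hx⟩ := x
  induction hx using adjoin_induction with
  | mem x hx =>
    obtain rfl := Set.mem_singleton_iff.1 hx
    exact hτ
  | algebraMap x =>
    exact (hτσ x).symm ▸ hσ x
  | add x y hx hy h1 h2 =>
    have := h1.add h2
    rwa [← map_add] at this
  | mul x y hx hy h1 h2 =>
    have := h1.mul h2
    rwa [← map_mul] at this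
  | inv x hx h =>
    by_cases h0 : x = 0
    · subst h0
      simpa using h
    · have := h.inv h0
      rwa [← map_inv₀] at this

end

/-- A finitely generated subextension of `ℝ` over a real closed subfield `F` embeds
over `F` into every nonprincipal ultrapower of `F`. -/
theorem exists_ringHom_germ {F : Subfield ℝ} (hF : IsRealClosedSubfield F)
    {U : Ultrafilter ℕ} (hU : (U : Filter ℕ) ≤ atTop) (S : Finset ℝ) :
    ∃ σ : adjoin F (S : Set ℝ) →+* Germ (U : Filter ℕ) F,
      ∀ c : F, σ (algebraMap F _ c) = (↑c : Germ (U : Filter ℕ) F) := by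
  suffices ∃ σ : adjoin F (S : Set ℝ) →+* Germ (U : Filter ℕ) F,
      (∀ c : F, σ (algebraMap F _ c) = (↑c : Germ (U : Filter ℕ) F)) ∧
        ∀ x, ConvergesTo (σ x) x from this.imp fun _ h => h.1
  refine induction_on_adjoin_finset S (fun L => ∃ σ : L →+* Germ (U : Filter ℕ) F,
      (∀ c : F, σ (algebraMap F _ c) = (↑c : Germ (U : Filter ℕ) F)) ∧
        ∀ x, ConvergesTo (σ x) x) ?_ ?_
  · let σ : F →+* Germ (U : Filter ℕ) F :=
      { toFun := fun c => (↑c : Germ (U : Filter ℕ) F)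
        map_one' := rfl
        map_mul' := fun _ _ => rfl
        map_zero' := rfl
        map_add' := fun _ _ => rfl }
    have hc (c : F) : (σ.comp (botEquiv F ℝ).toRingEquiv.toRingHom) (algebraMap F _ c) =
        (↑c : Germ (U : Filter ℕ) F) := congrArg σ ((botEquiv F ℝ).commutes c)
    refine ⟨_, hc, fun x => ?_⟩
    obtain ⟨c, rfl⟩ := (botEquiv F ℝ).symm.surjective x
    have := convergesTo_const (U := U) c
    rwa [← hc] at this
  · rintro L a - ⟨σ, hσF, hσ⟩
    obtain ⟨τ, hτ, hτl⟩ := exists_extension_convergesTo hF hU hσ a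
    exact ⟨τ, fun c => (hτ (algebraMap F L c)).trans (hσF c), hτl⟩

/-- Transfer: a system `p = 0`, `g ≠ 0` over a real closed subfield `F` of `ℝ`
which is solvable in `ℝ` is solvable in `F`. -/
theorem exists_eval_eq_zero_and_ne_zero {F : Subfield ℝ} (hF : IsRealClosedSubfield F)
    {ι : Type*} [Finite ι] (p g : MvPolynomial ι F) (y : ι → ℝ)
    (hp : MvPolynomial.aeval y p = 0) (hg : MvPolynomial.aeval y g ≠ 0) :
    ∃ z : ι → F, MvPolynomial.eval z p = 0 ∧ MvPolynomial.eval z g ≠ 0 := by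
  let U : Ultrafilter ℕ := hyperfilter ℕ
  obtain ⟨σ, hσ⟩ := exists_ringHom_germ hF (U := U) Nat.hyperfilter_le_atTop
    (Set.finite_range y).toFinset
  let y' (i : ι) : adjoin F ((Set.finite_range y).toFinset : Set ℝ) :=
    ⟨y i, subset_adjoin _ _ (by simp)⟩
  have hy' (r : MvPolynomial ι F) :
      ((MvPolynomial.aeval y' r : adjoin F _) : ℝ) = MvPolynomial.aeval y r :=
    (MvPolynomial.aeval_algebraMap_apply ℝ y' r).symm
  choose Y hY using fun i => (Quotient.exists_rep (σ (y' i)))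
  have hev (r : MvPolynomial ι F) : σ (MvPolynomial.aeval y' r) =
      ((fun n => MvPolynomial.eval (fun i => Y i n) r : ℕ → F) : Germ (U : Filter ℕ) F) := by
    induction r using MvPolynomial.induction_on with
    | C c =>
      rw [MvPolynomial.aeval_C, hσ]
      simp
      rfl
    | add p q hp hq =>
      simp only [map_add, hp, hq]
      rfl
    | mul_X p i hp =>
      simp only [map_mul, hp, MvPolynomial.aeval_X, MvPolynomial.eval_X, ← hY]
      rfl
  have h1 : ∀ᶠ n in (U : Filter ℕ), MvPolynomial.eval (fun i => Y i n) p = 0 := by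
    refine Germ.coe_eq.1 ((hev p).symm.trans ?_)
    rw [show MvPolynomial.aeval y' p = 0 from Subtype.ext ((hy' p).trans hp), map_zero]
    rfl
  have h2 : ∀ᶠ n in (U : Filter ℕ), MvPolynomial.eval (fun i => Y i n) g ≠ 0 := by
    refine Ultrafilter.eventually_not.2 fun h => hg ?_
    have h' : σ (MvPolynomial.aeval y' g) = 0 := (hev g).trans (Germ.coe_eq.2 h)
    rw [← hy', (map_eq_zero σ).1 h', ZeroMemClass.coe_zero]
  obtain ⟨n, hn⟩ := (h1.and h2).exists
  exact ⟨_, hn⟩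

/-- A real polynomial vanishing at the `F`-points of the zero locus of a polynomial over `F`
vanishes on the whole real zero locus. -/
theorem eval_eq_zero_of_forall_subfield {F : Subfield ℝ} (hF : IsRealClosedSubfield F)
    {ι : Type*} [Finite ι] (p : MvPolynomial ι F) (f : MvPolynomial ι ℝ)
    (hf : ∀ z : ι → F, MvPolynomial.eval z p = 0 →
      MvPolynomial.eval (fun i => (z i : ℝ)) f = 0)
    (y : ι → ℝ) (hy : MvPolynomial.aeval y p = 0) : MvPolynomial.eval y f = 0 := by
  classical
  let b := Module.Basis.ofVectorSpace F ℝ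
  let g (j : Module.Basis.ofVectorSpaceIndex F ℝ) : MvPolynomial ι F :=
    ∑ s ∈ f.support, MvPolynomial.monomial s (b.repr (f.coeff s) j)
  have hg (z : ι → F) (j) : MvPolynomial.eval z (g j) =
      b.repr (MvPolynomial.eval (fun i => (z i : ℝ)) f) j := by
    rw [MvPolynomial.eval_eq _ f, map_sum, map_sum, Finsupp.finsetSum_apply]
    refine Finset.sum_congr rfl fun s _ => ?_
    have : f.coeff s * ∏ i ∈ s.support, (z i : ℝ) ^ s i =
        (∏ i ∈ s.support, z i ^ s i) • f.coeff s := by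
      rw [Subfield.smul_def, smul_eq_mul, mul_comm]
      push_cast
      rfl
    rw [this, map_smul, MvPolynomial.eval_monomial, Finsupp.smul_apply, smul_eq_mul, mul_comm]
    rfl
  have hgy (j) : MvPolynomial.aeval y (g j) = 0 := by
    by_contra hne
    obtain ⟨z, hzp, hzg⟩ := exists_eval_eq_zero_and_ne_zero hF p (g j) y hy hne
    exact hzg (by rw [hg, hf z hzp]; simp)
  let J := f.support.biUnion fun s => (b.repr (f.coeff s)).support
  have hcoeff (s) (hs : s ∈ f.support) :
      f.coeff s = ∑ j ∈ J, (b.repr (f.coeff s) j : ℝ) * b j := by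
    conv_lhs => rw [← b.linearCombination_repr (f.coeff s), Finsupp.linearCombination_apply]
    exact Finsupp.sum_of_support_subset _ (Finset.subset_biUnion_of_mem
      (fun s => (b.repr (f.coeff s)).support) hs) _ (by simp)
  have hsum : MvPolynomial.eval y f = ∑ j ∈ J, b j * MvPolynomial.aeval y (g j) := by
    simp only [g, map_sum, MvPolynomial.aeval_monomial, Finset.mul_sum]
    rw [Finset.sum_comm, MvPolynomial.eval_eq]
    refine Finset.sum_congr rfl fun s hs => ?_
    conv_lhs => rw [hcoeff s hs, Finset.sum_mul]
    refine Finset.sum_congr rfl fun j _ => ?_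
    rw [Finsupp.prod, ← mul_assoc, mul_comm (b j)]
    rfl
  rw [hsum]
  exact Finset.sum_eq_zero fun j _ => by rw [hgy, mul_zero]

theorem exists_map_subtype_eq {F : Subfield ℝ} {ι : Type*} {p : MvPolynomial ι ℝ}
    (hp : ∀ s, p.coeff s ∈ F) : ∃ p' : MvPolynomial ι F, MvPolynomial.map F.subtype p' = p := by
  refine MvPolynomial.mem_range_map_iff_coeffs_subset.2 fun c hc => ?_
  obtain ⟨s, -, rfl⟩ := MvPolynomial.mem_coeffs_iff.1 hc
  exact ⟨⟨_, hp s⟩, rfl⟩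

/-- If A ⊆ ℝ^m and B ⊆ ℝ^n × ℝ^m are algebraic over a real closed subfield F,
then {x : ∀ y ∈ A, (x,y) ∈ B} is algebraic over F. -/
theorem universal_section_algebraic_over_subfield (n m : ℕ) (F : Subfield ℝ)
    (hF : IsRealClosedSubfield F)
    (p : MvPolynomial (Fin m) ℝ) (hp : ∀ s, MvPolynomial.coeff s p ∈ F)
    (q : MvPolynomial (Fin n ⊕ Fin m) ℝ) (hq : ∀ s, MvPolynomial.coeff s q ∈ F)
    (A : Set (Fin m → ℝ)) (hA : A = {y | MvPolynomial.eval y p = 0})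
    (B : Set ((Fin n → ℝ) × (Fin m → ℝ)))
    (hB : B = {z | MvPolynomial.eval (Sum.elim z.1 z.2) q = 0}) :
    ∃ r : MvPolynomial (Fin n) ℝ, (∀ s, MvPolynomial.coeff s r ∈ F) ∧
      {x | ∀ y ∈ A, (x, y) ∈ B} = {x | MvPolynomial.eval x r = 0} := by
  obtain ⟨p, rfl⟩ := exists_map_subtype_eq hp
  obtain ⟨q, rfl⟩ := exists_map_subtype_eq hq
  subst hA hB
  let s (z : Fin m → F) : MvPolynomial (Fin n) F :=
    MvPolynomial.aeval (Sum.elim MvPolynomial.X fun i => MvPolynomial.C (z i)) q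
  have hs (z : Fin m → F) (x : Fin n → ℝ) : MvPolynomial.aeval x (s z) =
      MvPolynomial.eval (Sum.elim x fun i => (z i : ℝ)) (MvPolynomial.map F.subtype q) := by
    rw [MvPolynomial.eval_map, ← AlgHom.comp_apply, MvPolynomial.comp_aeval]
    refine congrArg (fun w => MvPolynomial.eval₂ F.subtype w q) (funext ?_)
    rintro (i | i)
    · simp
    · simp
      rfl
  obtain ⟨T, hT, hspan⟩ := (Submodule.fg_span_iff_fg_span_finset_subset
    (R := MvPolynomial (Fin n) F) (s '' {z | MvPolynomial.eval z p = 0})).1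
      (IsNoetherian.noetherian _)
  have hr (x : Fin n → ℝ) : MvPolynomial.eval x (MvPolynomial.map F.subtype (∑ t ∈ T, t ^ 2)) =
      ∑ t ∈ T, (MvPolynomial.aeval x t) ^ 2 := by
    rw [MvPolynomial.eval_map]
    exact (map_sum (MvPolynomial.aeval x) _ _).trans (by simp)
  refine ⟨MvPolynomial.map F.subtype (∑ t ∈ T, t ^ 2),
    fun d => by rw [MvPolynomial.coeff_map]; exact Subtype.property _, ?_⟩
  ext x
  simp only [Set.mem_ofPred_eq]
  rw [hr]
  constructor
  · intro hx
    refine Finset.sum_eq_zero fun t ht => ?_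
    obtain ⟨z, hz, rfl⟩ := hT ht
    rw [hs, hx, zero_pow two_ne_zero]
    have hz' : MvPolynomial.eval z p = 0 := hz
    have h := MvPolynomial.aeval_algebraMap_apply ℝ z p
    rw [MvPolynomial.eval_map]
    refine h.trans ?_
    rw [MvPolynomial.aeval_eq_eval, hz', map_zero]
  · intro hx y hy
    have hxT (t) (ht : t ∈ T) : MvPolynomial.aeval x t = 0 :=
      pow_eq_zero_iff two_ne_zero |>.1
        ((Finset.sum_eq_zero_iff_of_nonneg fun _ _ => sq_nonneg _).1 hx t ht)
    have hker : Submodule.span (MvPolynomial (Fin n) F) (s '' {z | MvPolynomial.eval z p = 0}) ≤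
        RingHom.ker (MvPolynomial.aeval x : MvPolynomial (Fin n) F →ₐ[F] ℝ) := by
      rw [hspan]
      exact Submodule.span_le.2 hxT
    let f : MvPolynomial (Fin m) ℝ :=
      MvPolynomial.aeval (Sum.elim (fun i => MvPolynomial.C (x i)) MvPolynomial.X) q
    have hf (w : Fin m → ℝ) : MvPolynomial.eval w f =
        MvPolynomial.eval (Sum.elim x w) (MvPolynomial.map F.subtype q) := by
      rw [MvPolynomial.eval_map]
      change ((MvPolynomial.aeval w).restrictScalars F) f = _
      rw [← AlgHom.comp_apply, MvPolynomial.comp_aeval]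
      refine congrArg (fun w => MvPolynomial.eval₂ F.subtype w q) (funext ?_)
      rintro (i | i) <;> simp
    rw [← hf]
    refine eval_eq_zero_of_forall_subfield hF p f (fun z hz => ?_) y ?_
    · rw [hf, ← hs]
      exact hker (Submodule.subset_span ⟨z, hz, rfl⟩)
    · rw [MvPolynomial.eval_map] at hy
      exact hy
end

section
/- Let F be a real closed subfield of ℝ and A ⊆ ℝ^n an algebraic set defined over F. Then each irreducible component of A is an algebraic set defined over F. -/
open Module IntermediateField in
/-- Over a field of characteristic zero in which every polynomial of odd degree has a root, every
finite Galois extension has degree a power of two. -/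
theorem exists_finrank_eq_two_pow_s17 {F N : Type*} [Field F] [CharZero F] [Field N] [Algebra F N]
    [FiniteDimensional F N] [IsGalois F N]
    (hodd : ∀ p : Polynomial F, Odd p.natDegree → ∃ x, p.IsRoot x) :
    ∃ m, finrank F N = 2 ^ m := by
  obtain ⟨S⟩ : Nonempty (Sylow 2 Gal(N/F)) := inferInstance
  let M := fixedField (S : Subgroup Gal(N/F))
  have hM : finrank F M = (S : Subgroup Gal(N/F)).index := by
    rw [finrank_eq_fixingSubgroup_index, fixingSubgroup_fixedField]
  obtain ⟨β, hβ⟩ := Field.exists_primitive_element F M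
  have hβi : IsIntegral F β := Algebra.IsIntegral.isIntegral β
  have hdeg : (minpoly F β).natDegree = finrank F M := by
    rw [← IntermediateField.adjoin.finrank hβi, hβ, IntermediateField.finrank_top']
  have hOdd : Odd (minpoly F β).natDegree := by
    rw [hdeg, hM, ← Nat.not_even_iff_odd, even_iff_two_dvd]
    exact S.not_dvd_index
  obtain ⟨x, hx⟩ := hodd _ hOdd
  have h1 := Polynomial.natDegree_eq_of_degree_eq_some
    (Polynomial.degree_eq_one_of_irreducible_of_root (minpoly.irreducible hβi) hx)
  have hcard := (S : Subgroup Gal(N/F)).card_mul_index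
  rw [← hM, ← hdeg, show (minpoly F β).natDegree = 1 from h1, mul_one,
    IsGalois.card_aut_eq_finrank] at hcard
  exact ⟨_, by rw [← hcard, S.card_eq_multiplicity]⟩

open Module IntermediateField in
/-- In a finite Galois extension of degree a power of two, every proper intermediate extension
contains a quadratic extension of the base field. -/
theorem exists_le_finrank_eq_two {F N : Type*} [Field F] [Field N] [Algebra F N]
    [FiniteDimensional F N] [IsGalois F N] {m : ℕ} (hm : finrank F N = 2 ^ m)
    (K : IntermediateField F N) (hK : finrank F K ≠ 1) :
    ∃ M ≤ K, finrank F M = 2 := by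
  have hG : Nat.card Gal(N/F) = 2 ^ m := by rw [IsGalois.card_aut_eq_finrank, hm]
  obtain ⟨k, hkm, hk⟩ := (Nat.dvd_prime_pow Nat.prime_two).1
    (hG ▸ K.fixingSubgroup.card_subgroup_dvd_card)
  have hlt : k < m := by
    refine lt_of_le_of_ne hkm fun h => hK ?_
    rw [finrank_eq_fixingSubgroup_index]
    have := K.fixingSubgroup.card_mul_index
    rw [hk, hG, h] at this
    exact Nat.eq_of_mul_eq_mul_left (by positivity) (this.trans (mul_one _).symm)
  obtain ⟨H, hH, hle⟩ := Sylow.exists_subgroup_card_pow_prime_le 2 (m := m - 1)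
    (hG ▸ pow_dvd_pow 2 (Nat.sub_le m 1)) K.fixingSubgroup hk (by omega)
  refine ⟨fixedField H, ?_, ?_⟩
  · rw [← IsGalois.fixedField_fixingSubgroup K]
    exact fixedField_antitone hle
  · rw [finrank_eq_fixingSubgroup_index, fixingSubgroup_fixedField]
    have := H.card_mul_index
    rw [hH, hG, show m = m - 1 + 1 by omega, pow_succ] at this
    exact Nat.eq_of_mul_eq_mul_left (by positivity) this

open Module IntermediateField in
/-- Over a field of characteristic zero in which every polynomial of odd degree has a root, every
nontrivial finite extension contains a square root not lying in the base field. -/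
theorem exists_sq_mem_range_of_finrank_ne_one {F K : Type*} [Field F] [CharZero F] [Field K]
    [Algebra F K] [FiniteDimensional F K]
    (hodd : ∀ p : Polynomial F, Odd p.natDegree → ∃ x, p.IsRoot x) (hK : finrank F K ≠ 1) :
    ∃ x : K, x ∉ (algebraMap F K).range ∧ x ^ 2 ∈ (algebraMap F K).range := by
  let N := normalClosure F K (AlgebraicClosure K)
  have : IsGalois F N := {}
  obtain ⟨m, hm⟩ := exists_finrank_eq_two_pow_s17 (N := N) hodd
  let φ : K →ₐ[F] N := IsScalarTower.toAlgHom F K N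
  obtain ⟨M, hMK, hM⟩ := exists_le_finrank_eq_two hm φ.fieldRange
    ((AlgEquiv.ofInjectiveField φ).toLinearEquiv.finrank_eq.symm.trans_ne hK)
  have hMbot : M ≠ ⊥ := by
    rintro rfl
    rw [IntermediateField.finrank_bot] at hM
    omega
  obtain ⟨z, hzM, hz⟩ := SetLike.exists_of_lt (bot_lt_iff_ne_bot.2 hMbot)
  obtain ⟨w, rfl⟩ := hMK hzM
  have hw : w ∉ (algebraMap F K).range := by
    rintro ⟨a, rfl⟩
    exact hz (IntermediateField.mem_bot.2 ⟨a, (φ.commutes a).symm⟩)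
  have hwi : IsIntegral F w := Algebra.IsIntegral.isIntegral w
  have hdeg : (minpoly F w).natDegree = 2 := by
    have h1 : (minpoly F w).natDegree ∣ 2 := by
      rw [← hM, ← minpoly.algHom_eq φ φ.injective]
      have := minpoly.degree_dvd (K := F) (L := M) (x := ⟨φ w, hzM⟩)
        (Algebra.IsIntegral.isIntegral _)
      rwa [← minpoly.algHom_eq M.val M.val.injective] at this
    rcases (Nat.dvd_prime Nat.prime_two).1 h1 with h | h
    · exact absurd (minpoly.natDegree_eq_one_iff.1 h) hw
    · exact h
  have hroot := minpoly.aeval F w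
  have hlead : (minpoly F w).coeff 2 = 1 := by
    rw [← hdeg]; exact minpoly.monic hwi
  rw [Polynomial.aeval_eq_sum_range, hdeg] at hroot
  simp only [Finset.sum_range_succ, Finset.range_zero, Finset.sum_empty, hlead, Algebra.smul_def,
    map_one] at hroot
  set b := (minpoly F w).coeff 1
  set c := (minpoly F w).coeff 0
  have h2 : algebraMap F K 2 = 2 := map_ofNat _ 2
  have h20 : (2 : K) ≠ 0 := by
    rw [← h2]; exact (map_ne_zero _).2 two_ne_zero
  refine ⟨w + algebraMap F K (b / 2), fun ⟨a, ha⟩ => hw ⟨a - b / 2, ?_⟩, ⟨(b / 2) ^ 2 - c, ?_⟩⟩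
  · rw [map_sub, ha, add_sub_cancel_right]
  · simp only [map_sub, map_pow, map_div₀, h2]
    field_simp
    linear_combination (-4) * hroot

/-- A real closed subfield of the reals is algebraically closed in the reals. -/
theorem IsRealClosedSubfield.mem_of_isAlgebraic {F : Subfield ℝ} (hF : IsRealClosedSubfield F)
    {x : ℝ} (hx : IsAlgebraic F x) : x ∈ F := by
  have hodd : ∀ p : Polynomial F, Odd p.natDegree → ∃ x, p.IsRoot x := by
    intro p hp
    have hinj : Function.Injective (algebraMap F ℝ) := (algebraMap F ℝ).injective
    obtain ⟨y, hy, hpy⟩ := hF.2 (p.map (algebraMap F ℝ))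
      (by
        rw [Polynomial.map_ne_zero_iff hinj]
        rintro rfl
        simp at hp)
      (fun i => by rw [Polynomial.coeff_map]; exact (p.coeff i).2)
      (by rwa [Polynomial.natDegree_map_eq_of_injective hinj])
    refine ⟨⟨y, hy⟩, hinj ?_⟩
    rw [map_zero, ← hpy, Polynomial.eval_map]
    exact Polynomial.hom_eval₂ _ (RingHom.id F) (algebraMap F ℝ) _
  have : FiniteDimensional F (IntermediateField.adjoin F {x}) :=
    IntermediateField.adjoin.finiteDimensional hx.isIntegral
  by_contra hxF
  obtain ⟨y, hy, d, hd⟩ := exists_sq_mem_range_of_finrank_ne_one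
    (K := IntermediateField.adjoin F {x}) hodd fun h => hxF <| by
      rw [IntermediateField.finrank_adjoin_simple_eq_one_iff, IntermediateField.mem_bot] at h
      obtain ⟨a, rfl⟩ := h
      exact a.2
  have hd' : (d : ℝ) = (y : ℝ) ^ 2 := congrArg Subtype.val hd
  obtain ⟨z, hz, hzd⟩ := hF.1 d d.2 (hd' ▸ sq_nonneg _)
  have hyF : (y : ℝ) ∈ F := by
    rcases sq_eq_sq_iff_eq_or_eq_neg.1 (hd'.symm.trans hzd.symm) with h | h
    · exact h ▸ hz
    · exact h ▸ neg_mem hz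
  exact hy ⟨⟨y, hyF⟩, rfl⟩
/-- Let `m` have minimal degree among the polynomials whose image under `φ` is nonzero and vanishes
at `y`. If `ψ` kills the kernel of `φ` but not the leading coefficient of `m`, and `z` is a root of
the image of `m` under `ψ`, then every relation satisfied by `y` over `φ` is satisfied by `z` over
`ψ`. -/
theorem Polynomial.eval₂_eq_zero_of_minimal {R K : Type*} [CommRing R] [Field K] {φ ψ : R →+* K}
    (hker : ∀ r, φ r = 0 → ψ r = 0) {y z : K} {m : Polynomial R} (hm : 0 < m.natDegree)
    (hmin : ∀ g : Polynomial R, g.natDegree < m.natDegree → g.eval₂ φ y = 0 → g.map φ = 0)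
    (hy : m.eval₂ φ y = 0) (hlead : ψ m.leadingCoeff ≠ 0) (hz : m.eval₂ ψ z = 0)
    (g : Polynomial R) (hg : g.eval₂ φ y = 0) : g.eval₂ ψ z = 0 := by
  induction hd : g.natDegree using Nat.strong_induction_on generalizing g with
  | _ d ih =>
    subst hd
    rcases lt_or_ge g.natDegree m.natDegree with h | h
    · have h0 : g.map ψ = 0 := by
        ext i
        have := congrArg (Polynomial.coeff · i) (hmin g h hg)
        simp only [Polynomial.coeff_map, Polynomial.coeff_zero] at this ⊢
        exact hker _ this
      rw [← Polynomial.eval_map, h0, Polynomial.eval_zero]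
    · have := ih _ (Polynomial.natDegree_cancelLeads_lt_of_natDegree_le_natDegree h (hm.trans_le h))
        (m.cancelLeads g) (by simp [Polynomial.cancelLeads, Polynomial.eval₂_mul, hg, hy]) rfl
      simpa [Polynomial.cancelLeads, Polynomial.eval₂_mul, hz, Nat.sub_eq_zero_of_le h,
        hlead] using this

/-- A real polynomial changes sign arbitrarily close to a simple root. -/
theorem Polynomial.exists_mul_neg_of_simple_root {f : Polynomial ℝ} {y : ℝ} (hy : f.eval y = 0)
    (hy' : f.derivative.eval y ≠ 0) {W : Set ℝ} (hW : W ∈ nhds y) :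
    ∃ a b, Set.uIcc a b ⊆ W ∧ f.eval a * f.eval b < 0 := by
  obtain ⟨q, rfl⟩ := Polynomial.dvd_iff_isRoot.2 hy
  have hq : q.eval y ≠ 0 := by simpa [Polynomial.derivative_mul] using hy'
  have hpos : ∀ᶠ t in nhds y, 0 < q.eval t * q.eval y :=
    (q.continuous.mul continuous_const).continuousAt.eventually
      (lt_mem_nhds (mul_self_pos.2 hq))
  obtain ⟨ε, hε, hball⟩ := Metric.nhds_basis_closedBall.mem_iff.1 (Filter.inter_mem hW hpos)
  rw [Real.closedBall_eq_Icc] at hball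
  refine ⟨y - ε, y + ε, ?_, ?_⟩
  · rw [Set.uIcc_of_le (by linarith)]
    exact hball.trans Set.inter_subset_left
  · have h1 : 0 < q.eval (y - ε) * q.eval y := (hball ⟨le_rfl, by linarith⟩).2
    have h2 : 0 < q.eval (y + ε) * q.eval y := (hball ⟨by linarith, le_rfl⟩).2
    have h3 : 0 < q.eval (y - ε) * q.eval (y + ε) := by
      by_contra! h
      nlinarith [mul_pos h1 h2, mul_self_pos.2 hq]
    simp only [Polynomial.eval_mul, Polynomial.eval_sub, Polynomial.eval_X, Polynomial.eval_C]
    nlinarith [mul_pos h3 (mul_pos hε hε)]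

theorem MvPolynomial.aeval_eq_eval₂_finSuccEquiv {R S : Type*} [CommRing R] [CommRing S]
    [Algebra R S] {n : ℕ} (P : Fin n → S) (y : S) (g : MvPolynomial (Fin (n + 1)) R) :
    aeval (Fin.cons y P : Fin (n + 1) → S) g =
      (finSuccEquiv R n g).eval₂ (aeval P : MvPolynomial (Fin n) R →ₐ[R] S).toRingHom y := by
  induction g using MvPolynomial.induction_on with
  | C r => simp [finSuccEquiv_apply]
  | add p q hp hq => simp only [map_add, Polynomial.eval₂_add, hp, hq]
  | mul_X p i hp =>
    rw [map_mul, map_mul, Polynomial.eval₂_mul, hp]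
    cases i using Fin.cases <;> simp [finSuccEquiv_X_zero, finSuccEquiv_X_succ]

theorem MvPolynomial.continuous_aeval_real {F : Subfield ℝ} {σ : Type*} (g : MvPolynomial σ F) :
    Continuous fun x : σ → ℝ => aeval x g := by
  simp only [aeval_def, ← eval_map]
  exact continuous_eval _

theorem Subfield.exists_mem_of_mem_nhds (F : Subfield ℝ) {y : ℝ} {W : Set ℝ} (hW : W ∈ nhds y) :
    ∃ z ∈ W, z ∈ F := by
  obtain ⟨z, hz, q, rfl⟩ := mem_closure_iff_nhds.1 (Rat.denseRange_cast (𝕜 := ℝ) y) W hW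
  exact ⟨q, hz, SubfieldClass.ratCast_mem F q⟩

/-- The `F`-rational specializations of a real point `P` (the `F`-points satisfying every
polynomial relation over `F` satisfied by `P`) accumulate at `P`. -/
theorem IsRealClosedSubfield.exists_specialization_fin {F : Subfield ℝ}
    (hF : IsRealClosedSubfield F) (n : ℕ) (P : Fin n → ℝ) {U : Set (Fin n → ℝ)} (hU : U ∈ nhds P) :
    ∃ Q ∈ U, (∀ i, Q i ∈ F) ∧ ∀ g : MvPolynomial (Fin n) F,
      MvPolynomial.aeval P g = 0 → MvPolynomial.aeval Q g = 0 := by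
  induction n with
  | zero => exact ⟨P, mem_of_mem_nhds hU, fun i => i.elim0, fun _ => id⟩
  | succ n ih =>
    obtain ⟨y, P, rfl⟩ : ∃ y P', P = Fin.cons y P' :=
      ⟨P 0, Fin.tail P, (Fin.cons_self_tail P).symm⟩
    have hcons : Continuous fun t : ℝ × (Fin n → ℝ) => (Fin.cons t.1 t.2 : Fin (n + 1) → ℝ) :=
      Continuous.finCons (A := fun _ => ℝ) continuous_fst continuous_snd
    obtain ⟨W, hW, V, hV, hWV⟩ := mem_nhds_prod_iff.1 (hcons.continuousAt (x := (y, P)) hU)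
    set φ := (MvPolynomial.aeval P : MvPolynomial (Fin n) F →ₐ[F] ℝ).toRingHom
    suffices h : ∃ Q ∈ V, (∀ i, Q i ∈ F) ∧ ∃ z ∈ W, z ∈ F ∧
        ∀ g : Polynomial (MvPolynomial (Fin n) F), g.eval₂ φ y = 0 →
          g.eval₂ (MvPolynomial.aeval Q : MvPolynomial (Fin n) F →ₐ[F] ℝ).toRingHom z = 0 by
      obtain ⟨Q, hQV, hQF, z, hzW, hzF, hg⟩ := h
      refine ⟨Fin.cons z Q, hWV (Set.mk_mem_prod hzW hQV), Fin.cases hzF hQF, fun g => ?_⟩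
      rw [MvPolynomial.aeval_eq_eval₂_finSuccEquiv, MvPolynomial.aeval_eq_eval₂_finSuccEquiv]
      exact hg _
    by_cases hy : ∃ m : Polynomial (MvPolynomial (Fin n) F), m.eval₂ φ y = 0 ∧ m.map φ ≠ 0
    · obtain ⟨m, ⟨hmy, hm0⟩, hmin⟩ := WellFounded.has_min
        (measure (Polynomial.natDegree (R := MvPolynomial (Fin n) F))).wf
        {m | m.eval₂ φ y = 0 ∧ m.map φ ≠ 0} hy
      replace hmin : ∀ g : Polynomial (MvPolynomial (Fin n) F), g.natDegree < m.natDegree →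
          g.eval₂ φ y = 0 → g.map φ = 0 := fun g hg hgy => by
        by_contra h
        exact hmin g ⟨hgy, h⟩ hg
      have hdeg : 0 < m.natDegree := by
        by_contra! h
        rw [Polynomial.eq_C_of_natDegree_le_zero h] at hmy hm0
        rw [Polynomial.eval₂_C] at hmy
        rw [Polynomial.map_C, hmy, map_zero] at hm0
        exact hm0 rfl
      have hlead : φ m.leadingCoeff ≠ 0 := by
        intro h
        have hmap : m.eraseLead.map φ = m.map φ := by
          conv_rhs => rw [← m.eraseLead_add_C_mul_X_pow]
          simp only [Polynomial.map_add, Polynomial.map_mul, Polynomial.map_C, h, map_zero, zero_mul,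
            add_zero]
        refine hm0 (hmap ▸ hmin _ ?_ ?_)
        · exact (Polynomial.eraseLead_natDegree_le m).trans_lt (by omega)
        · rw [← Polynomial.eval_map, hmap, Polynomial.eval_map, hmy]
      have hder : (m.map φ).derivative.eval y ≠ 0 := by
        intro h
        rw [Polynomial.derivative_map, Polynomial.eval_map] at h
        have h0 := hmin _ (Polynomial.natDegree_derivative_lt hdeg.ne') h
        rw [← Polynomial.derivative_map] at h0
        have hC := Polynomial.eq_C_of_derivative_eq_zero h0
        rw [← Polynomial.eval_map, hC, Polynomial.eval_C] at hmy
        rw [hmy, map_zero] at hC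
        exact hm0 hC
      obtain ⟨a, b, hab, hneg⟩ := Polynomial.exists_mul_neg_of_simple_root
        (by rw [Polynomial.eval_map, hmy]) hder hW
      have hcont : ∀ c : ℝ, Continuous fun Q : Fin n → ℝ =>
          (m.map (MvPolynomial.aeval Q : MvPolynomial (Fin n) F →ₐ[F] ℝ).toRingHom).eval c := by
        intro c
        simp only [Polynomial.eval_map, Polynomial.eval₂_eq_sum_range]
        exact continuous_finsetSum _ fun i _ =>
          (MvPolynomial.continuous_aeval_real (m.coeff i)).mul continuous_const
      have hV' := Filter.inter_mem hV <| Filter.inter_mem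
        (((hcont a).mul (hcont b)).continuousAt.eventually (gt_mem_nhds hneg))
        ((MvPolynomial.continuous_aeval_real m.leadingCoeff).continuousAt.eventually_ne hlead)
      obtain ⟨Q, ⟨hQV, hQneg, hQlead⟩, hQF, hQ⟩ := ih P hV'
      set ψ := (MvPolynomial.aeval Q : MvPolynomial (Fin n) F →ₐ[F] ℝ).toRingHom
      obtain ⟨z, hz, hz0⟩ : (0 : ℝ) ∈ (fun t => (m.map ψ).eval t) '' Set.uIcc a b := by
        refine intermediate_value_uIcc (m.map ψ).continuous.continuousOn ?_
        rw [Set.mem_uIcc]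
        rcases mul_neg_iff.1 (show (m.map ψ).eval a * (m.map ψ).eval b < 0 from hQneg) with h | h
        · exact Or.inr ⟨h.2.le, h.1.le⟩
        · exact Or.inl ⟨h.1.le, h.2.le⟩
      refine ⟨Q, hQV, hQF, z, hab hz, ?_, ?_⟩
      · refine hF.mem_of_isAlgebraic ?_
        let ψ₀ := (MvPolynomial.aeval fun i => (⟨Q i, hQF i⟩ : F) :
          MvPolynomial (Fin n) F →ₐ[F] F).toRingHom
        have hψ : (algebraMap F ℝ).comp ψ₀ = ψ := by
          ext r
          · simp [ψ₀, ψ]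
          · simp [ψ₀, ψ]
            rfl
        have hmap : (m.map ψ₀).map (algebraMap F ℝ) = m.map ψ := by rw [Polynomial.map_map, hψ]
        refine ⟨m.map ψ₀, fun h => hQlead ?_, ?_⟩
        · have := congrArg (Polynomial.coeff · m.natDegree) hmap
          rw [h] at this
          simp only [Polynomial.coeff_map, Polynomial.map_zero, Polynomial.coeff_zero] at this
          exact this.symm
        · rw [Polynomial.aeval_def, ← Polynomial.eval_map, hmap]
          exact hz0
      · exact Polynomial.eval₂_eq_zero_of_minimal hQ hdeg hmin hmy hQlead
          (by rw [← Polynomial.eval_map]; exact hz0)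
    · push Not at hy
      obtain ⟨Q, hQV, hQF, hQ⟩ := ih P hV
      obtain ⟨z, hzW, hzF⟩ := F.exists_mem_of_mem_nhds hW
      refine ⟨Q, hQV, hQF, z, hzW, hzF, fun g hg => ?_⟩
      rw [Polynomial.eval₂_eq_sum_range]
      refine Finset.sum_eq_zero fun i _ => ?_
      have := congrArg (Polynomial.coeff · i) (hy g hg)
      simp only [Polynomial.coeff_map, Polynomial.coeff_zero] at this
      exact mul_eq_zero_of_left (hQ _ this) _

/-- The `F`-rational specializations of a real point `P` indexed by a finite type accumulate
at `P`. -/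
theorem IsRealClosedSubfield.exists_specialization {F : Subfield ℝ}
    (hF : IsRealClosedSubfield F) {σ : Type*} [Finite σ] (P : σ → ℝ) {U : Set (σ → ℝ)}
    (hU : U ∈ nhds P) :
    ∃ Q ∈ U, (∀ i, Q i ∈ F) ∧ ∀ g : MvPolynomial σ F,
      MvPolynomial.aeval P g = 0 → MvPolynomial.aeval Q g = 0 := by
  obtain ⟨n, ⟨e⟩⟩ := Finite.exists_equiv_fin σ
  have hcont : Continuous fun Q : Fin n → ℝ => Q ∘ e := continuous_pi fun i => continuous_apply _
  obtain ⟨Q, hQU, hQF, hQ⟩ := hF.exists_specialization_fin n (P ∘ e.symm)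
    (hcont.continuousAt (x := P ∘ e.symm) (by simpa [Function.comp_assoc] using hU))
  refine ⟨Q ∘ e, hQU, fun i => hQF _, fun g hg => ?_⟩
  rw [← MvPolynomial.aeval_rename]
  apply hQ
  rwa [MvPolynomial.aeval_rename, Function.comp_assoc, e.symm_comp_self, Function.comp_id]

open MvPolynomial in
/-- The `F`-rational points are dense in an algebraic set defined over `F`. -/
theorem IsRealClosedSubfield.exists_mem_zeroLocus {F : Subfield ℝ} (hF : IsRealClosedSubfield F)
    {σ : Type*} [Finite σ] {I : Ideal (MvPolynomial σ F)} {x : σ → ℝ} (hx : x ∈ zeroLocus ℝ I)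
    {U : Set (σ → ℝ)} (hU : U ∈ nhds x) :
    ∃ y ∈ U, (∀ i, y i ∈ F) ∧ y ∈ zeroLocus ℝ I := by
  obtain ⟨y, hyU, hyF, hy⟩ := hF.exists_specialization x hU
  exact ⟨y, hyU, hyF, fun g hg => hy g (hx g hg)⟩

/-- The value at `x` of the polynomial with exponents in `S` and coefficients `c`. -/
def polyValue {σ : Type*} [Fintype σ] (S : Finset (σ →₀ ℕ)) (x : σ → ℝ) (c : S → ℝ) : ℝ :=
  ∑ s, c s * ∏ i, x i ^ s.1 i

theorem continuous_polyValue {σ : Type*} [Fintype σ] (S : Finset (σ →₀ ℕ)) (x : σ → ℝ) :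
    Continuous (polyValue S x) := by
  unfold polyValue
  fun_prop

theorem polyValue_support_coeff {σ : Type*} [Fintype σ] (f : MvPolynomial σ ℝ) (x : σ → ℝ) :
    polyValue f.support x (fun s => f.coeff s) = MvPolynomial.eval x f := by
  rw [MvPolynomial.eval_eq', polyValue]
  exact Finset.sum_coe_sort f.support fun s => f.coeff s * ∏ i, x i ^ s i

open MvPolynomial in
theorem exists_aeval_eq_polyValue_of_coeff_mem {F : Subfield ℝ} {σ : Type*} [Fintype σ]
    (S : Finset (σ →₀ ℕ)) {c : S → ℝ} (hc : ∀ s, c s ∈ F) :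
    ∃ f : MvPolynomial σ F, ∀ x : σ → ℝ, aeval x f = polyValue S x c := by
  refine ⟨∑ s, monomial s.1 ⟨c s, hc s⟩, fun x => ?_⟩
  simp only [map_sum, aeval_monomial, polyValue]
  refine Finset.sum_congr rfl fun s _ => ?_
  rw [Finsupp.prod_fintype _ _ (by simp)]
  rfl

open MvPolynomial in
theorem exists_aeval_eq_polyValue_of_point_mem {F : Subfield ℝ} {σ τ : Type*} [Fintype σ]
    (S : Finset (σ →₀ ℕ)) (ι : S → τ) {x : σ → ℝ} (hx : ∀ i, x i ∈ F) :
    ∃ f : MvPolynomial τ F, ∀ c : τ → ℝ, aeval c f = polyValue S x (c ∘ ι) := by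
  refine ⟨∑ s, X (ι s) * C (∏ i, ⟨x i, hx i⟩ ^ s.1 i), fun c => ?_⟩
  simp only [map_sum, map_mul, aeval_X, polyValue, Function.comp_apply, map_prod, map_pow,
    algHom_C]
  rfl

open MvPolynomial in
/-- If a prime ideal of polynomials over `F` is the vanishing ideal of a set of real points, then
its real zero locus is irreducible as a real algebraic set. -/
theorem IsRealClosedSubfield.eval_eq_zero_or_of_mul {F : Subfield ℝ} (hF : IsRealClosedSubfield F)
    {σ : Type*} [Fintype σ] {D : Set (σ → ℝ)} (hD : (vanishingIdeal F D).IsPrime)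
    {f g : MvPolynomial σ ℝ}
    (hfg : ∀ x ∈ zeroLocus ℝ (vanishingIdeal F D), eval x f * eval x g = 0) :
    (∀ x ∈ zeroLocus ℝ (vanishingIdeal F D), eval x f = 0) ∨
      ∀ x ∈ zeroLocus ℝ (vanishingIdeal F D), eval x g = 0 := by
  by_contra! h
  obtain ⟨⟨x, hx, hfx⟩, y, hy, hgy⟩ := h
  obtain ⟨x', hfx', hxF, hx'⟩ := hF.exists_mem_zeroLocus hx
    ((continuous_eval f).continuousAt.eventually_ne hfx)
  obtain ⟨y', hgy', hyF, hy'⟩ := hF.exists_mem_zeroLocus hy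
    ((continuous_eval g).continuousAt.eventually_ne hgy)
  have hfx'' : eval x' f ≠ 0 := hfx'
  have hgy'' : eval y' g ≠ 0 := hgy'
  rw [← polyValue_support_coeff] at hfx'' hgy''
  let P : f.support ⊕ g.support → ℝ := Sum.elim (fun s => f.coeff s) fun s => g.coeff s
  have hc₁ : Continuous fun c : f.support ⊕ g.support → ℝ =>
      polyValue f.support x' (c ∘ Sum.inl) :=
    (continuous_polyValue _ _).comp (continuous_pi fun _ => continuous_apply _)
  have hc₂ : Continuous fun c : f.support ⊕ g.support → ℝ =>
      polyValue g.support y' (c ∘ Sum.inr) :=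
    (continuous_polyValue _ _).comp (continuous_pi fun _ => continuous_apply _)
  obtain ⟨c, ⟨hcf, hcg⟩, hcF, hc⟩ := hF.exists_specialization P <| Filter.inter_mem
    (hc₁.continuousAt.eventually_ne hfx'') (hc₂.continuousAt.eventually_ne hgy'')
  obtain ⟨f', hf'⟩ := exists_aeval_eq_polyValue_of_coeff_mem f.support (c := c ∘ Sum.inl)
    fun s => hcF _
  obtain ⟨g', hg'⟩ := exists_aeval_eq_polyValue_of_coeff_mem g.support (c := c ∘ Sum.inr)
    fun s => hcF _
  have hmem : f' * g' ∈ vanishingIdeal F D := by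
    intro z hz
    by_contra hne
    obtain ⟨w, hw, hwF, hwE⟩ := hF.exists_mem_zeroLocus (zeroLocus_vanishingIdeal_le D hz)
      ((continuous_aeval_real (f' * g')).continuousAt.eventually_ne hne)
    obtain ⟨A, hA⟩ := exists_aeval_eq_polyValue_of_point_mem f.support
      (Sum.inl : _ → f.support ⊕ g.support) hwF
    obtain ⟨B, hB⟩ := exists_aeval_eq_polyValue_of_point_mem g.support
      (Sum.inr : _ → f.support ⊕ g.support) hwF
    refine hw ?_
    rw [map_mul, hf', hg', ← hA, ← hB, ← map_mul]
    refine hc _ ?_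
    rw [map_mul, hA, hB, ← hfg w hwE, ← polyValue_support_coeff f, ← polyValue_support_coeff g]
    rfl
  rcases hD.mem_or_mem hmem with h | h
  · exact hcf (by rw [← hf']; exact hx' _ h)
  · exact hcg (by rw [← hg']; exact hy' _ h)

open MvPolynomial in
theorem IsIrreducibleAlg.vanishingIdeal_isPrime {n : ℕ} {D : Set (Fin n → ℝ)}
    (hD : IsIrreducibleAlg n D) (F : Subfield ℝ) : (vanishingIdeal F D).IsPrime := by
  obtain ⟨⟨x, hx⟩, ⟨S, hS⟩, hirr⟩ := hD
  refine ⟨fun h => ?_, fun {f g} hfg => ?_⟩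
  · simpa using (h ▸ Submodule.mem_top : (1 : MvPolynomial (Fin n) F) ∈ vanishingIdeal F D) x hx
  · have halg : ∀ f : MvPolynomial (Fin n) F, IsAlgebraicSet n {x | x ∈ D ∧ aeval x f = 0} :=
      fun f => ⟨insert (map (algebraMap F ℝ) f) S, by
        ext x
        simp [hS, aeval_def, eval_map, and_comm]⟩
    rcases hirr _ _ (halg f) (halg g) (by
      ext x
      refine ⟨fun hx => ?_, fun hx => hx.elim And.left And.left⟩
      have := hfg x hx
      rw [map_mul] at this
      exact (mul_eq_zero.1 this).imp (⟨hx, ·⟩) (⟨hx, ·⟩)) with h | h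
    · exact Or.inl fun x hx => (h.subset hx).2
    · exact Or.inr fun x hx => (h.subset hx).2

open MvPolynomial in
theorem IsRealClosedSubfield.isIrreducibleAlg_zeroLocus {F : Subfield ℝ}
    (hF : IsRealClosedSubfield F) {n : ℕ} {D : Set (Fin n → ℝ)} (hD : IsIrreducibleAlg n D) :
    IsIrreducibleAlg n (zeroLocus ℝ (vanishingIdeal F D)) := by
  refine ⟨hD.1.mono (zeroLocus_vanishingIdeal_le D),
    ⟨map (algebraMap F ℝ) '' (vanishingIdeal F D : Set (MvPolynomial (Fin n) F)), ?_⟩, ?_⟩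
  · ext x
    simp only [mem_zeroLocus_iff, Set.mem_ofPred_eq, Set.forall_mem_image, eval_map, aeval_def,
      SetLike.mem_coe]
  · rintro _ _ ⟨S, rfl⟩ ⟨T, rfl⟩ h
    by_contra! hne
    have hex : ∀ S : Set (MvPolynomial (Fin n) ℝ), {x | ∀ p ∈ S, eval x p = 0} ⊆
        zeroLocus ℝ (vanishingIdeal F D) →
        zeroLocus ℝ (vanishingIdeal F D) ≠ {x | ∀ p ∈ S, eval x p = 0} →
        ∃ f ∈ S, ¬ ∀ x ∈ zeroLocus ℝ (vanishingIdeal F D), eval x f = 0 := by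
      intro S hS hne
      by_contra! hall
      exact hne (Set.Subset.antisymm (fun x hx f hf => hall f hf x hx) hS)
    obtain ⟨f, hfS, hf⟩ := hex S (h ▸ Set.subset_union_left) hne.1
    obtain ⟨g, hgT, hg⟩ := hex T (h ▸ Set.subset_union_right) hne.2
    refine (hF.eval_eq_zero_or_of_mul (hD.vanishingIdeal_isPrime F) (f := f) (g := g)
      fun x hx => ?_).elim hf hg
    rcases h.subset hx with hx | hx
    · rw [hx f hfS, zero_mul]
    · rw [hx g hgT, mul_zero]

open MvPolynomial in
/-- The real zero locus of an ideal over a subfield of the reals is the zero set of a single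
polynomial. -/
theorem exists_zeroLocus_eq_setOf_aeval_eq_zero {F : Subfield ℝ} {σ : Type*} [Finite σ]
    (I : Ideal (MvPolynomial σ F)) :
    ∃ q : MvPolynomial σ F, zeroLocus ℝ I = {x | aeval x q = 0} := by
  obtain ⟨T, rfl⟩ := IsNoetherian.noetherian I
  refine ⟨∑ g ∈ T, g ^ 2, ?_⟩
  ext x
  rw [show zeroLocus ℝ (Submodule.span _ (T : Set (MvPolynomial σ F))) = _ from zeroLocus_span _]
  simp only [Set.mem_ofPred_eq, map_sum, map_pow]
  rw [Finset.sum_eq_zero_iff_of_nonneg fun _ _ => sq_nonneg _]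
  simp

/-- Each irreducible component of an algebraic set defined over a real closed
subfield F is itself defined over F. An irreducible component of A is a maximal
irreducible algebraic subset of A. -/
theorem irreducible_component_over_subfield (n : ℕ) (F : Subfield ℝ)
    (hF : IsRealClosedSubfield F)
    (p : MvPolynomial (Fin n) ℝ) (hp : ∀ s, MvPolynomial.coeff s p ∈ F)
    (A : Set (Fin n → ℝ)) (hA : A = {x | MvPolynomial.eval x p = 0})
    (D : Set (Fin n → ℝ)) (hD : IsIrreducibleAlg n D) (hDA : D ⊆ A)
    (hmax : ∀ D' : Set (Fin n → ℝ), IsIrreducibleAlg n D' → D ⊆ D' → D' ⊆ A → D' = D) :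
    ∃ q : MvPolynomial (Fin n) ℝ, (∀ s, MvPolynomial.coeff s q ∈ F) ∧
      D = {x | MvPolynomial.eval x q = 0} := by
  subst hA
  obtain ⟨q, hq⟩ := exists_zeroLocus_eq_setOf_aeval_eq_zero (MvPolynomial.vanishingIdeal F D)
  have heval : ∀ (g : MvPolynomial (Fin n) F) (x : Fin n → ℝ),
      MvPolynomial.eval x (MvPolynomial.map (algebraMap F ℝ) g) = MvPolynomial.aeval x g :=
    fun g x => by rw [MvPolynomial.eval_map, MvPolynomial.aeval_def]
  obtain ⟨p, rfl⟩ : ∃ p₀ : MvPolynomial (Fin n) F, MvPolynomial.map (algebraMap F ℝ) p₀ = p :=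
    MvPolynomial.mem_range_map_iff_coeffs_subset.2 <| by
      rintro _ hc
      obtain ⟨s, -, rfl⟩ := MvPolynomial.mem_coeffs_iff.1 hc
      exact ⟨⟨_, hp s⟩, rfl⟩
  refine ⟨MvPolynomial.map (algebraMap F ℝ) q, fun s => ?_, ?_⟩
  · rw [MvPolynomial.coeff_map]
    exact (q.coeff s).2
  · simp only [heval, ← hq] at hDA hmax ⊢
    refine (hmax _ (hF.isIrreducibleAlg_zeroLocus hD)
      (MvPolynomial.zeroLocus_vanishingIdeal_le D) fun x hx => ?_).symm
    exact hx p fun y hy => hDA hy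
end
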